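/- For any link (i,j) of a weighted graph, the link resistance curvature satisfies κ_ij ≤ (6 − 2β(G_i∖(i,j)) − β(G_i∖{i,j}))/ω_ij, where G_i is the connected component containing (i,j), G_i∖(i,j) is G_i with the link (i,j) removed, and G_i∖{i,j} is G_i with the nodes i and j (and all their incident links) removed; this bound (as well as the lower bound (4 − d_i − d_j)/ω_ij) is attained, with both bounds equal, if and only if all links incident to i and to j are cut links. -/

import Mathlib

open Matrix

variable {V : Type*}

/- The weighted Laplacian matrix of a weighted graph `(V, G, c)`:
`Q i i = ∑_{k ∼ i} c i k`, `Q i j = -c i j` for links `i ∼ j`, and `0` otherwise. -/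
open Classical in
noncomputable def lapMatrix [Fintype V] (G : SimpleGraph V) (c : V → V → ℝ) :
    Matrix V V ℝ :=
  Matrix.of fun i j =>
    if i = j then ∑ k, if G.Adj i k then c i k else 0
    else if G.Adj i j then -c i j else 0

/- The four Penrose equations characterizing the Moore–Penrose pseudoinverse. -/
def IsMoorePenroseInv [Fintype V] (Q Qd : Matrix V V ℝ) : Prop :=
  Q * Qd * Q = Q ∧ Qd * Q * Qd = Qd ∧ (Q * Qd)ᵀ = Q * Qd ∧ (Qd * Q)ᵀ = Qd * Q

/- The effective resistance `ω i j = (e_i - e_j)ᵀ Q† (e_i - e_j)`, computed from a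
pseudoinverse `Qd` of the Laplacian. -/
open Classical in
noncomputable def effRes [Fintype V] (Qd : Matrix V V ℝ) (i j : V) : ℝ :=
  (Pi.single i 1 - Pi.single j 1) ⬝ᵥ Qd *ᵥ (Pi.single i 1 - Pi.single j 1)

/- The node resistance curvature `p i = 1 - (1/2) ∑_{j ∼ i} c i j * ω i j`. -/
open Classical in
noncomputable def nodeCurv [Fintype V] (G : SimpleGraph V) (c : V → V → ℝ)
    (Qd : Matrix V V ℝ) (i : V) : ℝ :=
  1 - 1 / 2 * ∑ j, if G.Adj i j then c i j * effRes Qd i j else 0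

/- The link resistance curvature `κ i j = 2 (p i + p j) / ω i j`. -/
noncomputable def linkCurv [Fintype V] (G : SimpleGraph V) (c : V → V → ℝ)
    (Qd : Matrix V V ℝ) (i j : V) : ℝ :=
  2 * (nodeCurv G c Qd i + nodeCurv G c Qd j) / effRes Qd i j

/- A link is a cut link (bridge) if its removal increases the number of
connected components of the graph. -/
def IsCutLink (G : SimpleGraph V) (i j : V) : Prop :=
  G.Adj i j ∧
    Nat.card G.ConnectedComponent <
      Nat.card (G.deleteEdges {s(i, j)}).ConnectedComponent

/-- The weight of the pair `(u, v)`: the link weight if `u ∼ v`, and `0` otherwise. -/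
noncomputable def pairWeight (G : SimpleGraph V) (c : V → V → ℝ) (u v : V) : ℝ :=
  open Classical in if G.Adj u v then c u v else 0

section Weights

variable {G : SimpleGraph V} {c : V → V → ℝ}

lemma pairWeight_of_adj {u v : V} (h : G.Adj u v) : pairWeight G c u v = c u v := by
  simp [pairWeight, h]

lemma pairWeight_of_not_adj {u v : V} (h : ¬ G.Adj u v) : pairWeight G c u v = 0 := by
  simp [pairWeight, h]

lemma pairWeight_comm (hsymm : ∀ i j, c i j = c j i) (u v : V) :
    pairWeight G c u v = pairWeight G c v u := by
  by_cases h : G.Adj u v <;> simp [pairWeight, G.adj_comm v u, hsymm u v, h]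

lemma pairWeight_nonneg (hpos : ∀ i j, G.Adj i j → 0 < c i j) (u v : V) :
    0 ≤ pairWeight G c u v := by
  by_cases h : G.Adj u v
  · rw [pairWeight_of_adj h]; exact (hpos u v h).le
  · rw [pairWeight_of_not_adj h]

end Weights

section Laplacian

variable [Fintype V] {G : SimpleGraph V} {c : V → V → ℝ}

lemma lapMatrix_mulVec_apply (x : V → ℝ) (u : V) :
    (lapMatrix G c *ᵥ x) u = ∑ v, pairWeight G c u v * (x u - x v) := by
  classical
  have h : ∀ v, lapMatrix G c u v * x v =
      (if u = v then (∑ k, pairWeight G c u k) * x u else 0) - pairWeight G c u v * x v := by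
    intro v
    by_cases huv : u = v
    · subst huv
      simp [lapMatrix, pairWeight]
    · by_cases ha : G.Adj u v <;> simp [lapMatrix, pairWeight, huv, ha]
  simp only [mulVec, dotProduct, h, Finset.sum_sub_distrib, mul_sub, Finset.sum_ite_eq,
    Finset.mem_univ, if_true, Finset.sum_mul]

lemma lapMatrix_transpose (hsymm : ∀ i j, c i j = c j i) :
    (lapMatrix G c)ᵀ = lapMatrix G c := by
  ext u v
  by_cases huv : u = v
  · subst huv; rfl
  · by_cases h : G.Adj u v <;> simp [lapMatrix, huv, Ne.symm huv, G.adj_comm v u, hsymm v u, h]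

lemma dotProduct_lapMatrix_mulVec (hsymm : ∀ i j, c i j = c j i) (y x : V → ℝ) :
    y ⬝ᵥ lapMatrix G c *ᵥ x =
      1 / 2 * ∑ u, ∑ v, pairWeight G c u v * ((y u - y v) * (x u - x v)) := by
  have h1 : y ⬝ᵥ lapMatrix G c *ᵥ x =
      ∑ u, ∑ v, pairWeight G c u v * (y u * (x u - x v)) := by
    simp only [dotProduct, lapMatrix_mulVec_apply, Finset.mul_sum]
    exact Finset.sum_congr rfl fun u _ => Finset.sum_congr rfl fun v _ => by ring
  have h2 : y ⬝ᵥ lapMatrix G c *ᵥ x =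
      ∑ u, ∑ v, pairWeight G c u v * (y v * (x v - x u)) := by
    rw [h1, Finset.sum_comm]
    exact Finset.sum_congr rfl fun u _ => Finset.sum_congr rfl fun v _ => by
      rw [pairWeight_comm hsymm]
  have h3 : ∑ u, ∑ v, pairWeight G c u v * ((y u - y v) * (x u - x v)) =
      (∑ u, ∑ v, pairWeight G c u v * (y u * (x u - x v))) +
      ∑ u, ∑ v, pairWeight G c u v * (y v * (x v - x u)) := by
    simp only [← Finset.sum_add_distrib]
    exact Finset.sum_congr rfl fun u _ => Finset.sum_congr rfl fun v _ => by ring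
  rw [h3, ← h1, ← h2]; ring

lemma lapMatrix_energy_nonneg (hsymm : ∀ i j, c i j = c j i)
    (hpos : ∀ i j, G.Adj i j → 0 < c i j) (x : V → ℝ) :
    0 ≤ x ⬝ᵥ lapMatrix G c *ᵥ x := by
  rw [dotProduct_lapMatrix_mulVec hsymm]
  have := Finset.sum_nonneg fun u (_ : u ∈ Finset.univ) =>
    Finset.sum_nonneg fun v (_ : v ∈ Finset.univ) =>
      mul_nonneg (pairWeight_nonneg hpos u v) (mul_self_nonneg (x u - x v))
  linarith

/-- The energy of a potential dominates the contributions of any two different links. -/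
lemma link_energies_le (hsymm : ∀ i j, c i j = c j i)
    (hpos : ∀ i j, G.Adj i j → 0 < c i j) (x : V → ℝ) {i j k l : V}
    (hij : G.Adj i j) (hkl : G.Adj k l) (hne : s(i, j) ≠ s(k, l)) :
    c i j * (x i - x j) ^ 2 + c k l * (x k - x l) ^ 2 ≤ x ⬝ᵥ lapMatrix G c *ᵥ x := by
  classical
  rw [dotProduct_lapMatrix_mulVec hsymm, ← Finset.sum_product']
  have hs : ({(i, j), (j, i), (k, l), (l, k)} : Finset (V × V)) ⊆
      Finset.univ ×ˢ Finset.univ := fun _ _ => by simp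
  have := Finset.sum_le_sum_of_subset_of_nonneg
    (f := fun p : V × V => pairWeight G c p.1 p.2 * ((x p.1 - x p.2) * (x p.1 - x p.2))) hs
    fun p _ _ => mul_nonneg (pairWeight_nonneg hpos p.1 p.2) (mul_self_nonneg _)
  have h1 := hij.ne
  have h2 := hkl.ne
  simp only [ne_eq, Sym2.eq_iff, not_or, not_and] at hne
  rw [Finset.sum_insert (by simp; grind), Finset.sum_insert (by simp; grind),
    Finset.sum_insert (by simp; grind), Finset.sum_singleton] at this
  simp only [pairWeight_of_adj hij, pairWeight_of_adj hij.symm, pairWeight_of_adj hkl,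
    pairWeight_of_adj hkl.symm, hsymm j i, hsymm l k] at this
  nlinarith

lemma link_energy_le (hsymm : ∀ i j, c i j = c j i)
    (hpos : ∀ i j, G.Adj i j → 0 < c i j) (x : V → ℝ) {i j : V} (hij : G.Adj i j) :
    c i j * (x i - x j) ^ 2 ≤ x ⬝ᵥ lapMatrix G c *ᵥ x := by
  classical
  rw [dotProduct_lapMatrix_mulVec hsymm, ← Finset.sum_product']
  have hs : ({(i, j), (j, i)} : Finset (V × V)) ⊆
      Finset.univ ×ˢ Finset.univ := fun _ _ => by simp
  have := Finset.sum_le_sum_of_subset_of_nonneg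
    (f := fun p : V × V => pairWeight G c p.1 p.2 * ((x p.1 - x p.2) * (x p.1 - x p.2))) hs
    fun p _ _ => mul_nonneg (pairWeight_nonneg hpos p.1 p.2) (mul_self_nonneg _)
  rw [Finset.sum_insert (by simp [hij.ne]), Finset.sum_singleton] at this
  simp only [pairWeight_of_adj hij, pairWeight_of_adj hij.symm, hsymm j i] at this
  nlinarith

/-- The effective resistance of a link is the potential drop of the unit current flow
from one end to the other. -/
lemma exists_potential (hsymm : ∀ i j, c i j = c j i)
    (hpos : ∀ i j, G.Adj i j → 0 < c i j) {Qd : Matrix V V ℝ}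
    (hQd : IsMoorePenroseInv (lapMatrix G c) Qd) {i j : V} (hij : G.Adj i j) :
    ∃ x : V → ℝ, effRes Qd i j = x i - x j ∧
      ∀ y : V → ℝ, y ⬝ᵥ lapMatrix G c *ᵥ x = y i - y j := by
  classical
  have hdot : ∀ y : V → ℝ, y ⬝ᵥ (Pi.single i 1 - Pi.single j 1) = y i - y j := fun y => by
    simp [dotProduct_sub]
  obtain ⟨h1, -, h3, -⟩ := hQd
  set Q := lapMatrix G c with hQ
  have hT : Qᵀ = Q := lapMatrix_transpose hsymm
  set b : V → ℝ := Pi.single i 1 - Pi.single j 1 with hb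
  have hQQ : Q * (Q * Qd) = Q := by
    have := congrArg transpose h1
    rwa [transpose_mul, hT, h3] at this
  set z := b - Q *ᵥ (Qd *ᵥ b) with hz
  have hQz : Q *ᵥ z = 0 := by
    rw [hz, mulVec_sub, mulVec_mulVec, mulVec_mulVec, Matrix.mul_assoc, hQQ, sub_self]
  have hzij : z i - z j = 0 := by
    have := link_energy_le hsymm hpos z hij
    rw [← hQ, hQz, dotProduct_zero] at this
    have hc := hpos i j hij
    by_contra hne
    have : 0 < c i j * (z i - z j) ^ 2 := by positivity
    linarith
  have hzz : z ⬝ᵥ z = 0 := by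
    have h5 : z ⬝ᵥ Q *ᵥ (Qd *ᵥ b) = 0 := by
      rw [dotProduct_mulVec, ← mulVec_transpose, hT, hQz, zero_dotProduct]
    nth_rewrite 2 [hz]
    rw [dotProduct_sub, h5, hdot, hzij, sub_zero]
  have hz0 : z = 0 := dotProduct_self_eq_zero.mp hzz
  have hbQ : Q *ᵥ (Qd *ᵥ b) = b := (sub_eq_zero.mp hz0).symm
  refine ⟨Qd *ᵥ b, ?_, fun y => by rw [hbQ, hdot]⟩
  rw [← hdot, dotProduct_comm, effRes, hb]

/-- Dirichlet's principle for the effective resistance of a link. -/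
lemma sq_sub_le_effRes_mul_energy (hsymm : ∀ i j, c i j = c j i)
    (hpos : ∀ i j, G.Adj i j → 0 < c i j) {Qd : Matrix V V ℝ}
    (hQd : IsMoorePenroseInv (lapMatrix G c) Qd) {i j : V} (hij : G.Adj i j) (y : V → ℝ) :
    (y i - y j) ^ 2 ≤ effRes Qd i j * (y ⬝ᵥ lapMatrix G c *ᵥ y) := by
  obtain ⟨x, hx, hQx⟩ := exists_potential hsymm hpos hQd hij
  have hxy : x ⬝ᵥ lapMatrix G c *ᵥ y = y i - y j := by
    rw [← hQx, dotProduct_lapMatrix_mulVec hsymm, dotProduct_lapMatrix_mulVec hsymm]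
    simp only [mul_comm (x _ - x _)]
  have key : ∀ t : ℝ, 0 ≤ (y ⬝ᵥ lapMatrix G c *ᵥ y) * (t * t) +
      (2 * (y i - y j)) * t + effRes Qd i j := by
    intro t
    have := lapMatrix_energy_nonneg hsymm hpos (x + t • y)
    simp only [mulVec_add, mulVec_smul, dotProduct_add, add_dotProduct, smul_dotProduct,
      dotProduct_smul, smul_eq_mul, hQx, hxy, Pi.add_apply, Pi.smul_apply] at this
    linarith
  have := discrim_le_zero key
  rw [discrim] at this
  linarith

lemma effRes_pos (hsymm : ∀ i j, c i j = c j i)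
    (hpos : ∀ i j, G.Adj i j → 0 < c i j) {Qd : Matrix V V ℝ}
    (hQd : IsMoorePenroseInv (lapMatrix G c) Qd) {i j : V} (hij : G.Adj i j) :
    0 < effRes Qd i j := by
  classical
  have h := sq_sub_le_effRes_mul_energy hsymm hpos hQd hij (Pi.single i 1)
  have h0 := lapMatrix_energy_nonneg hsymm hpos (G := G) (Pi.single i 1)
  simp only [Pi.single_eq_same, Pi.single_eq_of_ne hij.ne', sub_zero, one_pow] at h
  by_contra hneg
  nlinarith

lemma effRes_link_le_one (hsymm : ∀ i j, c i j = c j i)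
    (hpos : ∀ i j, G.Adj i j → 0 < c i j) {Qd : Matrix V V ℝ}
    (hQd : IsMoorePenroseInv (lapMatrix G c) Qd) {i j : V} (hij : G.Adj i j) :
    c i j * effRes Qd i j ≤ 1 := by
  obtain ⟨x, hx, hQx⟩ := exists_potential hsymm hpos hQd hij
  have h := link_energy_le hsymm hpos x hij
  have hω := effRes_pos hsymm hpos hQd hij
  rw [hQx, ← hx] at h
  by_contra! hlt
  nlinarith

/-- If the relative resistance of a link is `1`, the unit current flow uses only this link,
which therefore separates its ends. -/
lemma not_reachable_of_effRes_link_eq_one (hsymm : ∀ i j, c i j = c j i)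
    (hpos : ∀ i j, G.Adj i j → 0 < c i j) {Qd : Matrix V V ℝ}
    (hQd : IsMoorePenroseInv (lapMatrix G c) Qd) {i j : V} (hij : G.Adj i j)
    (h1 : c i j * effRes Qd i j = 1) :
    ¬ (G.deleteEdges {s(i, j)}).Reachable i j := by
  obtain ⟨x, hx, hQx⟩ := exists_potential hsymm hpos hQd hij
  have hω := effRes_pos hsymm hpos hQd hij
  have hconst : ∀ u v, (G.deleteEdges {s(i, j)}).Adj u v → x u = x v := by
    intro u v huv
    rw [SimpleGraph.deleteEdges_adj] at huv
    have h := link_energies_le hsymm hpos x hij huv.1 (Ne.symm (by simpa using huv.2))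
    rw [hQx, ← hx] at h
    have hc := hpos u v huv.1
    by_contra hne
    have hne' : x u - x v ≠ 0 := sub_ne_zero.mpr hne
    have : 0 < c u v * (x u - x v) ^ 2 := by positivity
    nlinarith
  rintro ⟨p⟩
  have hwalk : ∀ u v (p : (G.deleteEdges {s(i, j)}).Walk u v), x u = x v := by
    intro u v p
    induction p with
    | nil => rfl
    | cons h _ ih => exact (hconst _ _ h).trans ih
  linarith [hwalk _ _ p]

/-- The energy of the indicator function of `S` is the total weight of its boundary. -/
lemma energy_indicator (S : Set V) [DecidablePred (· ∈ S)] :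
    (fun v => if v ∈ S then (1 : ℝ) else 0) ⬝ᵥ lapMatrix G c *ᵥ
      (fun v => if v ∈ S then (1 : ℝ) else 0) =
    ∑ u, ∑ v, if u ∈ S ∧ v ∉ S then pairWeight G c u v else 0 := by
  simp only [dotProduct, lapMatrix_mulVec_apply, Finset.mul_sum]
  refine Finset.sum_congr rfl fun u _ => Finset.sum_congr rfl fun v _ => ?_
  by_cases hu : u ∈ S <;> by_cases hv : v ∈ S <;> simp [hu, hv]

/-- If a link is the only one leaving `S`, its relative resistance is at least `1`. -/
lemma one_le_effRes_link_of_boundary (hsymm : ∀ i j, c i j = c j i)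
    (hpos : ∀ i j, G.Adj i j → 0 < c i j) {Qd : Matrix V V ℝ}
    (hQd : IsMoorePenroseInv (lapMatrix G c) Qd) {i j : V} (hij : G.Adj i j)
    {S : Set V} (hi : i ∈ S) (hj : j ∉ S)
    (hS : ∀ u v, u ∈ S → v ∉ S → G.Adj u v → u = i ∧ v = j) :
    1 ≤ c i j * effRes Qd i j := by
  classical
  have h := sq_sub_le_effRes_mul_energy hsymm hpos hQd hij (fun v => if v ∈ S then (1 : ℝ) else 0)
  rw [energy_indicator] at h
  have hsum : ∑ u, ∑ v, (if u ∈ S ∧ v ∉ S then pairWeight G c u v else 0) = c i j := by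
    rw [Finset.sum_eq_single i, Finset.sum_eq_single j]
    · simp [hi, hj, pairWeight_of_adj hij]
    · intro v _ hv
      split_ifs with h
      · exact pairWeight_of_not_adj fun ha => hv (hS _ _ h.1 h.2 ha).2
      · rfl
    · simp
    · intro u _ hu
      refine Finset.sum_eq_zero fun v _ => ?_
      split_ifs with h
      · exact pairWeight_of_not_adj fun ha => hu (hS _ _ h.1 h.2 ha).1
      · rfl
    · simp
  rw [hsum] at h
  simp only [hi, hj, if_true, if_false] at h
  linarith

/-- If all links leaving `S` end in `i` or `j`, and there is such a link, then the relative
resistances of these links add up to at least `1`. -/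
lemma one_le_sum_effRes_boundary (hsymm : ∀ i j, c i j = c j i)
    (hpos : ∀ i j, G.Adj i j → 0 < c i j) {Qd : Matrix V V ℝ}
    (hQd : IsMoorePenroseInv (lapMatrix G c) Qd) {i j : V} (hij : i ≠ j)
    {S : Finset V} (hi : i ∉ S) (hj : j ∉ S)
    (hS : ∀ u v, u ∈ S → v ∉ S → G.Adj u v → v = i ∨ v = j)
    (hex : ∃ u v, u ∈ S ∧ v ∉ S ∧ G.Adj u v) :
    1 ≤ ∑ v ∈ S, (pairWeight G c i v * effRes Qd i v + pairWeight G c j v * effRes Qd j v) := by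
  classical
  set κ := ∑ v ∈ S, (pairWeight G c i v + pairWeight G c j v) with hκ
  have hE : (fun v => if v ∈ (S : Set V) then (1 : ℝ) else 0) ⬝ᵥ lapMatrix G c *ᵥ
      (fun v => if v ∈ (S : Set V) then (1 : ℝ) else 0) = κ := by
    rw [energy_indicator, hκ, ← Finset.sum_subset (Finset.subset_univ S)]
    · refine Finset.sum_congr rfl fun u hu => ?_
      rw [← Finset.sum_subset (Finset.subset_univ {i, j}), Finset.sum_pair hij]
      · simp [hu, hi, hj, pairWeight_comm hsymm u]
      · intro v _ hv
        split_ifs with h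
        · refine pairWeight_of_not_adj fun ha => hv ?_
          simpa using hS u v hu (by simpa using h.2) ha
        · rfl
    · intro u _ hu
      simp [hu]
  have hterm : ∀ a, a ∉ S → ∀ v ∈ S,
      pairWeight G c a v ≤ κ * (pairWeight G c a v * effRes Qd a v) := by
    intro a ha v hv
    by_cases hadj : G.Adj a v
    · have h := sq_sub_le_effRes_mul_energy hsymm hpos hQd hadj
        (fun v => if v ∈ (S : Set V) then (1 : ℝ) else 0)
      rw [hE] at h
      simp only [Finset.mem_coe, ha, hv, if_true, if_false] at h
      have hc := pairWeight_nonneg hpos a v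
      nlinarith
    · simp [pairWeight_of_not_adj hadj]
  have hκpos : 0 < κ := by
    obtain ⟨u, v, hu, hv, huv⟩ := hex
    refine Finset.sum_pos' (fun v _ => add_nonneg (pairWeight_nonneg hpos _ _)
      (pairWeight_nonneg hpos _ _)) ⟨u, hu, ?_⟩
    rcases hS u v hu hv huv with rfl | rfl
    · rw [pairWeight_of_adj huv.symm]
      exact add_pos_of_pos_of_nonneg (hpos _ _ huv.symm) (pairWeight_nonneg hpos _ _)
    · rw [pairWeight_of_adj huv.symm]
      exact add_pos_of_nonneg_of_pos (pairWeight_nonneg hpos _ _) (hpos _ _ huv.symm)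
  have hle : κ ≤ κ * ∑ v ∈ S,
      (pairWeight G c i v * effRes Qd i v + pairWeight G c j v * effRes Qd j v) := by
    rw [Finset.mul_sum, hκ]
    refine Finset.sum_le_sum fun v hv => ?_
    rw [← hκ, mul_add]
    exact add_le_add (hterm i hi v hv) (hterm j hj v hv)
  by_contra! hlt
  nlinarith

end Laplacian

section Components

open SimpleGraph

variable {W : Type*}

lemma reachable_deleteEdges_or {H : SimpleGraph W} {a b : W} {v : W}
    (hv : H.Reachable v a) :
    (H.deleteEdges {s(a, b)}).Reachable v a ∨ (H.deleteEdges {s(a, b)}).Reachable v b := by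
  have key : ∀ u w (_ : H.Walk u w),
      ((H.deleteEdges {s(a, b)}).Reachable w a ∨ (H.deleteEdges {s(a, b)}).Reachable w b) →
      ((H.deleteEdges {s(a, b)}).Reachable u a ∨ (H.deleteEdges {s(a, b)}).Reachable u b) := by
    intro u w p hw
    induction p with
    | nil => exact hw
    | @cons u x w h p ih =>
      by_cases hx : s(u, x) = s(a, b)
      · rcases Sym2.eq_iff.mp hx with ⟨rfl, -⟩ | ⟨rfl, -⟩
        · exact Or.inl (Reachable.refl _)
        · exact Or.inr (Reachable.refl _)
      · have hadj : (H.deleteEdges {s(a, b)}).Adj u x := by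
          rw [deleteEdges_adj]; exact ⟨h, by simpa using hx⟩
        exact (ih hw).imp hadj.reachable.trans hadj.reachable.trans
  obtain ⟨p⟩ := hv
  exact key v a p (Or.inl (Reachable.refl _))

lemma card_connectedComponent_le_two {H : SimpleGraph W} {a b : W}
    (h : ∀ v, H.Reachable v a ∨ H.Reachable v b) : Nat.card H.ConnectedComponent ≤ 2 := by
  have hsurj : Function.Surjective
      (fun t : Bool => H.connectedComponentMk (if t then a else b)) := by
    intro C
    induction C using ConnectedComponent.ind with | h v
    rcases h v with hv | hv
    · exact ⟨true, by simpa using hv.symm⟩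
    · exact ⟨false, by simpa using hv.symm⟩
  simpa using Nat.card_le_card_of_surjective _ hsurj

lemma card_connectedComponent_le_one {H : SimpleGraph W} {a : W}
    (h : ∀ v, H.Reachable v a) : Nat.card H.ConnectedComponent ≤ 1 := by
  have hsurj : Function.Surjective (fun _ : Unit => H.connectedComponentMk a) := by
    intro C
    induction C using ConnectedComponent.ind with | h v
    exact ⟨(), by simpa using (h v).symm⟩
  simpa using Nat.card_le_card_of_surjective _ hsurj

lemma two_le_card_connectedComponent [Finite W] {H : SimpleGraph W} {a b : W}
    (h : ¬ H.Reachable a b) : 2 ≤ Nat.card H.ConnectedComponent := by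
  have hinj : Function.Injective
      (fun t : Bool => H.connectedComponentMk (if t then a else b)) := by
    have h' : ¬ H.Reachable b a := fun hr => h hr.symm
    intro s t hst
    cases s <;> cases t <;> simp_all
  simpa using Nat.card_le_card_of_injective _ hinj

lemma isCutLink_iff [Finite V] {G : SimpleGraph V} {i j : V} :
    IsCutLink G i j ↔ G.Adj i j ∧ G.IsBridge s(i, j) := by
  refine and_congr_right fun hadj => ?_
  rw [isBridge_iff]
  have hsurj : Function.Surjective
      (ConnectedComponent.map (Hom.ofLE (G.deleteEdges_le {s(i, j)}))) := by
    intro C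
    induction C using ConnectedComponent.ind with | h v
    exact ⟨(G.deleteEdges {s(i, j)}).connectedComponentMk v, rfl⟩
  constructor
  · intro hlt hr
    refine hlt.not_ge (Nat.card_le_card_of_injective
      (ConnectedComponent.map (Hom.ofLE (G.deleteEdges_le {s(i, j)}))) ?_)
    · intro C D
      induction C using ConnectedComponent.ind with | h u
      induction D using ConnectedComponent.ind with | h v
      intro h
      have huv : G.Reachable u v := ConnectedComponent.exact h
      have hpre : ∀ u v (_ : G.Walk u v), (G.deleteEdges {s(i, j)}).Reachable u v := by
        intro u v p
        induction p with
        | nil => exact Reachable.refl _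
        | @cons u x w h p ih =>
          refine Reachable.trans ?_ ih
          by_cases hx : s(u, x) = s(i, j)
          · rcases Sym2.eq_iff.mp hx with ⟨rfl, rfl⟩ | ⟨rfl, rfl⟩
            · exact hr
            · exact hr.symm
          · exact Adj.reachable (by rw [deleteEdges_adj]; exact ⟨h, by simpa using hx⟩)
      obtain ⟨p⟩ := huv
      exact ConnectedComponent.sound (hpre u v p)
  · intro hr
    refine lt_of_le_of_ne (Nat.card_le_card_of_surjective _ hsurj) fun heq => ?_
    have hbij := (Function.Surjective.bijective_of_nat_card_le hsurj heq.ge)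
    exact hr (ConnectedComponent.exact (hbij.1 (ConnectedComponent.sound hadj.reachable)))

lemma induce_reachable {G : SimpleGraph V} {i : V} (v : {v | G.Reachable i v}) :
    (induce {v | G.Reachable i v} G).Reachable v ⟨i, Reachable.refl i⟩ := by
  classical
  obtain ⟨p⟩ : G.Reachable i v := v.2
  exact (Walk.reachable (p.induce {v | G.Reachable i v}
    fun w hw => (p.takeUntil w hw).reachable)).symm

/-- If the link `x ∼ a` is a bridge, where `x` is `i` or `j`, it is the only link from `{i, j}`
to its component in the complement of `{i, j}`. -/
lemma link_unique_of_isBridge {G : SimpleGraph V} {i j x y : V} (hx : x = i ∨ x = j)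
    (hy : y = i ∨ y = j) (hxy : x = y ∨ G.Adj x y)
    {a b : {v | G.Reachable i v ∧ v ≠ i ∧ v ≠ j}} (hyb : G.Adj y b)
    (hbr : G.IsBridge s(x, (a : V)))
    (hab : (induce {v | G.Reachable i v ∧ v ≠ i ∧ v ≠ j} G).Reachable a b) :
    x = y ∧ a = b := by
  obtain ⟨a, ha, hai, haj⟩ := a
  obtain ⟨b, hb, hbi, hbj⟩ := b
  rw [isBridge_iff] at hbr
  by_contra hne
  apply hbr
  have h1 : (G.deleteEdges {s(x, a)}).Reachable x y := by
    rcases hxy with rfl | hxy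
    · exact Reachable.refl _
    · refine Adj.reachable ?_
      rw [deleteEdges_adj]
      refine ⟨hxy, ?_⟩
      simp only [Set.mem_singleton_iff, Sym2.eq_iff]
      grind
  have h2 : (G.deleteEdges {s(x, a)}).Adj y b := by
    rw [deleteEdges_adj]
    refine ⟨hyb, ?_⟩
    simp only [Subtype.mk.injEq] at hne
    simp only [Set.mem_singleton_iff, Sym2.eq_iff]
    grind
  have h3 : (G.deleteEdges {s(x, a)}).Reachable a b := by
    let f : induce {v | G.Reachable i v ∧ v ≠ i ∧ v ≠ j} G →g G.deleteEdges {s(x, a)} :=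
      { toFun := Subtype.val
        map_rel' := fun {u v} huv => by
          have hu := u.2.2
          have hv := v.2.2
          rw [deleteEdges_adj]
          refine ⟨huv, ?_⟩
          simp only [Set.mem_singleton_iff, Sym2.eq_iff]
          grind }
    exact hab.map f
  exact (h1.trans h2.reachable).trans h3.symm

lemma degree_add_degree_le [Fintype V] [DecidableEq V] {G : SimpleGraph V} [DecidableRel G.Adj]
    {i j : V} (hij : G.Adj i j) (hi : ∀ k, G.Adj i k → G.IsBridge s(i, k))
    (hj : ∀ k, G.Adj j k → G.IsBridge s(j, k)) :
    G.degree i + G.degree j ≤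
      Nat.card (induce {v | G.Reachable i v ∧ v ≠ i ∧ v ≠ j} G).ConnectedComponent + 2 := by
  have hA : ∀ a : ↥((G.neighborFinset i).erase j), G.Adj i a ∧ (a : V) ≠ j := fun a => by
    have := a.2
    rw [Finset.mem_erase, mem_neighborFinset] at this
    exact this.symm
  have hB : ∀ b : ↥((G.neighborFinset j).erase i), G.Adj j b ∧ (b : V) ≠ i := fun b => by
    have := b.2
    rw [Finset.mem_erase, mem_neighborFinset] at this
    exact this.symm
  let F := induce {v | G.Reachable i v ∧ v ≠ i ∧ v ≠ j} G
  let f : ↥((G.neighborFinset i).erase j) ⊕ ↥((G.neighborFinset j).erase i) →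
      F.ConnectedComponent := Sum.elim
    (fun a => F.connectedComponentMk
      ⟨a, (hA a).1.reachable, (hA a).1.ne', (hA a).2⟩)
    (fun b => F.connectedComponentMk
      ⟨b, hij.reachable.trans (hB b).1.reachable, (hB b).2, (hB b).1.ne'⟩)
  have hf : Function.Injective f := by
    rintro (a | a) (b | b) hab
    · have := link_unique_of_isBridge (Or.inl rfl) (Or.inl rfl) (Or.inl rfl) (hA b).1
        (hi _ (hA a).1) (ConnectedComponent.exact hab)
      exact congrArg Sum.inl (Subtype.ext (Subtype.mk.inj this.2))
    · have := link_unique_of_isBridge (Or.inl rfl) (Or.inr rfl) (Or.inr hij) (hB b).1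
        (hi _ (hA a).1) (ConnectedComponent.exact hab)
      exact absurd this.1 hij.ne
    · have := link_unique_of_isBridge (Or.inr rfl) (Or.inl rfl) (Or.inr hij.symm) (hA b).1
        (hj _ (hB a).1) (ConnectedComponent.exact hab)
      exact absurd this.1 hij.ne'
    · have := link_unique_of_isBridge (Or.inr rfl) (Or.inr rfl) (Or.inl rfl) (hB b).1
        (hj _ (hB a).1) (ConnectedComponent.exact hab)
      exact congrArg Sum.inr (Subtype.ext (Subtype.mk.inj this.2))
  have hcard : _ ≤ Nat.card
      (induce {v | G.Reachable i v ∧ v ≠ i ∧ v ≠ j} G).ConnectedComponent :=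
    Nat.card_le_card_of_injective f hf
  rw [Nat.card_sum, Nat.card_eq_fintype_card, Nat.card_eq_fintype_card, Fintype.card_coe,
    Fintype.card_coe, Finset.card_erase_of_mem (by simpa using hij),
    Finset.card_erase_of_mem (by simpa using hij.symm), card_neighborFinset_eq_degree,
    card_neighborFinset_eq_degree] at hcard
  omega

end Components

section Curvature

variable [Fintype V] {G : SimpleGraph V} {c : V → V → ℝ} {Qd : Matrix V V ℝ}

lemma effRes_comm (i j : V) : effRes Qd i j = effRes Qd j i := by
  classical
  rw [effRes, effRes, ← neg_sub, mulVec_neg, neg_dotProduct_neg]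

/-- The relative resistance of the pair `(u, v)`. -/
noncomputable def relRes (G : SimpleGraph V) (c : V → V → ℝ) (Qd : Matrix V V ℝ) (u v : V) : ℝ :=
  pairWeight G c u v * effRes Qd u v

lemma relRes_of_adj {u v : V} (h : G.Adj u v) :
    relRes G c Qd u v = c u v * effRes Qd u v := by
  rw [relRes, pairWeight_of_adj h]

lemma relRes_of_not_adj {u v : V} (h : ¬ G.Adj u v) : relRes G c Qd u v = 0 := by
  rw [relRes, pairWeight_of_not_adj h, zero_mul]

lemma relRes_comm (hsymm : ∀ i j, c i j = c j i) (u v : V) :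
    relRes G c Qd u v = relRes G c Qd v u := by
  rw [relRes, relRes, pairWeight_comm hsymm, effRes_comm]

lemma relRes_nonneg (hsymm : ∀ i j, c i j = c j i) (hpos : ∀ i j, G.Adj i j → 0 < c i j)
    (hQd : IsMoorePenroseInv (lapMatrix G c) Qd) (u v : V) : 0 ≤ relRes G c Qd u v := by
  by_cases h : G.Adj u v
  · rw [relRes_of_adj h]
    exact mul_nonneg (hpos u v h).le (effRes_pos hsymm hpos hQd h).le
  · rw [relRes_of_not_adj h]

lemma nodeCurv_eq (i : V) : nodeCurv G c Qd i = 1 - 1 / 2 * ∑ v, relRes G c Qd i v := by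
  simp only [nodeCurv, relRes, pairWeight, ite_mul, zero_mul]

lemma linkCurv_eq (i j : V) : linkCurv G c Qd i j =
    (4 - ∑ v, relRes G c Qd i v - ∑ v, relRes G c Qd j v) / effRes Qd i j := by
  rw [linkCurv, nodeCurv_eq, nodeCurv_eq]
  congr 1
  ring

lemma relRes_eq_one_iff_isBridge (hsymm : ∀ i j, c i j = c j i)
    (hpos : ∀ i j, G.Adj i j → 0 < c i j)
    (hQd : IsMoorePenroseInv (lapMatrix G c) Qd) {i j : V} (hij : G.Adj i j) :
    relRes G c Qd i j = 1 ↔ G.IsBridge s(i, j) := by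
  rw [relRes_of_adj hij, SimpleGraph.isBridge_iff]
  refine ⟨not_reachable_of_effRes_link_eq_one hsymm hpos hQd hij, fun h => ?_⟩
  refine le_antisymm (effRes_link_le_one hsymm hpos hQd hij) ?_
  refine one_le_effRes_link_of_boundary hsymm hpos hQd hij
    (S := {v | (G.deleteEdges {s(i, j)}).Reachable i v}) (SimpleGraph.Reachable.refl i) h ?_
  intro u v hu hv huv
  by_cases he : s(u, v) = s(i, j)
  · rcases Sym2.eq_iff.mp he with h' | ⟨rfl, rfl⟩
    · exact h'
    · exact absurd hu h
  · refine absurd (SimpleGraph.Reachable.trans hu (SimpleGraph.Adj.reachable ?_)) hv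
    rw [SimpleGraph.deleteEdges_adj]
    exact ⟨huv, by simpa using he⟩

lemma relRes_le_ite [DecidableRel G.Adj] (hsymm : ∀ i j, c i j = c j i)
    (hpos : ∀ i j, G.Adj i j → 0 < c i j)
    (hQd : IsMoorePenroseInv (lapMatrix G c) Qd) (i v : V) :
    relRes G c Qd i v ≤ if G.Adj i v then 1 else 0 := by
  split_ifs with h
  · rw [relRes_of_adj h]; exact effRes_link_le_one hsymm hpos hQd h
  · rw [relRes_of_not_adj h]

lemma sum_relRes_le_degree [DecidableRel G.Adj] (hsymm : ∀ i j, c i j = c j i)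
    (hpos : ∀ i j, G.Adj i j → 0 < c i j)
    (hQd : IsMoorePenroseInv (lapMatrix G c) Qd) (i : V) :
    ∑ v, relRes G c Qd i v ≤ G.degree i := by
  refine (Finset.sum_le_sum fun v _ => relRes_le_ite hsymm hpos hQd i v).trans_eq ?_
  rw [Finset.sum_boole, ← SimpleGraph.card_neighborFinset_eq_degree,
    SimpleGraph.neighborFinset_eq_filter]

lemma sum_relRes_eq_degree_iff [DecidableRel G.Adj] (hsymm : ∀ i j, c i j = c j i)
    (hpos : ∀ i j, G.Adj i j → 0 < c i j)
    (hQd : IsMoorePenroseInv (lapMatrix G c) Qd) (i : V) :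
    ∑ v, relRes G c Qd i v = G.degree i ↔ ∀ k, G.Adj i k → G.IsBridge s(i, k) := by
  have hdeg : (G.degree i : ℝ) = ∑ v, if G.Adj i v then 1 else 0 := by
    rw [Finset.sum_boole, ← SimpleGraph.card_neighborFinset_eq_degree,
      SimpleGraph.neighborFinset_eq_filter]
  rw [hdeg, Finset.sum_eq_sum_iff_of_le fun v _ => relRes_le_ite hsymm hpos hQd i v]
  refine forall_congr' fun k => ?_
  by_cases h : G.Adj i k
  · simp [h, relRes_eq_one_iff_isBridge hsymm hpos hQd h]
  · simp [h, relRes_of_not_adj h]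

lemma card_component_deleteEdges_le (hsymm : ∀ i j, c i j = c j i)
    (hpos : ∀ i j, G.Adj i j → 0 < c i j)
    (hQd : IsMoorePenroseInv (lapMatrix G c) Qd) {i j : V} (hij : G.Adj i j) :
    (Nat.card ((SimpleGraph.induce {v | G.Reachable i v} G).deleteEdges
      {s((⟨i, SimpleGraph.Reachable.refl (G := G) i⟩ : {v | G.Reachable i v}),
        (⟨j, hij.reachable⟩ : {v | G.Reachable i v}))}).ConnectedComponent : ℝ) ≤
    1 + relRes G c Qd i j := by
  set H := SimpleGraph.induce {v | G.Reachable i v} G with hH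
  set a : {v | G.Reachable i v} := ⟨i, SimpleGraph.Reachable.refl (G := G) i⟩ with ha
  set b : {v | G.Reachable i v} := ⟨j, hij.reachable⟩ with hb
  have hor : ∀ v, (H.deleteEdges {s(a, b)}).Reachable v a ∨
      (H.deleteEdges {s(a, b)}).Reachable v b := fun v =>
    reachable_deleteEdges_or (induce_reachable v)
  by_cases hr : (H.deleteEdges {s(a, b)}).Reachable b a
  · have h1 : Nat.card (H.deleteEdges {s(a, b)}).ConnectedComponent ≤ 1 :=
      card_connectedComponent_le_one fun v => (hor v).elim id fun h => h.trans hr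
    have h1' : (Nat.card (H.deleteEdges {s(a, b)}).ConnectedComponent : ℝ) ≤ 1 := by
      exact_mod_cast h1
    linarith [relRes_nonneg hsymm hpos hQd i j]
  · have h2 : (Nat.card (H.deleteEdges {s(a, b)}).ConnectedComponent : ℝ) ≤ 2 := by
      exact_mod_cast card_connectedComponent_le_two hor
    have hbr : G.IsBridge s(i, j) := by
      rw [SimpleGraph.isBridge_iff_forall_walk_mem_edges]
      intro p
      by_contra hp
      apply hr
      have hmem : ∀ w ∈ p.support, w ∈ {v | G.Reachable i v} := by
        classical
        exact fun w hw => (p.takeUntil w hw).reachable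
      refine (SimpleGraph.reachable_deleteEdges_iff_exists_walk.mpr
        ⟨p.induce {v | G.Reachable i v} hmem, fun hin => hp ?_⟩).symm
      have hedges : (p.induce {v | G.Reachable i v} hmem).edges.map (Sym2.map Subtype.val) =
          p.edges :=
        (SimpleGraph.Walk.edges_map (SimpleGraph.Embedding.induce {v | G.Reachable i v}).toHom
          (p.induce _ hmem)).symm.trans (congrArg SimpleGraph.Walk.edges (p.map_induce hmem))
      exact hedges ▸ List.mem_map_of_mem (f := Sym2.map Subtype.val) hin
    linarith [(relRes_eq_one_iff_isBridge hsymm hpos hQd hij).mpr hbr]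

lemma card_component_deleteVerts_le [DecidableEq V] (hsymm : ∀ i j, c i j = c j i)
    (hpos : ∀ i j, G.Adj i j → 0 < c i j)
    (hQd : IsMoorePenroseInv (lapMatrix G c) Qd) {i j : V} (hij : G.Adj i j) :
    (Nat.card (SimpleGraph.induce {v | G.Reachable i v ∧ v ≠ i ∧ v ≠ j} G).ConnectedComponent
      : ℝ) ≤ ∑ v ∈ {i, j}ᶜ, (relRes G c Qd i v + relRes G c Qd j v) := by
  classical
  set T := {v | G.Reachable i v ∧ v ≠ i ∧ v ≠ j} with hT
  set F := SimpleGraph.induce T G with hF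
  have : Fintype F.ConnectedComponent := Fintype.ofFinite _
  let S : F.ConnectedComponent → Finset V := fun C =>
    Finset.univ.filter fun v => ∃ h : v ∈ T, F.connectedComponentMk ⟨v, h⟩ = C
  have hS : ∀ C v, v ∈ S C ↔ ∃ h : v ∈ T, F.connectedComponentMk ⟨v, h⟩ = C := by simp [S]
  have hone : ∀ C, 1 ≤ ∑ v ∈ S C, (relRes G c Qd i v + relRes G c Qd j v) := by
    intro C
    have hi : i ∉ S C := fun h => ((hS C i).mp h).1.2.1 rfl
    have hj : j ∉ S C := fun h => ((hS C j).mp h).1.2.2 rfl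
    refine one_le_sum_effRes_boundary hsymm hpos hQd hij.ne hi hj ?_ ?_
    · intro u v hu hv huv
      by_contra! hne
      obtain ⟨huT, huC⟩ := (hS C u).mp hu
      have hvT : v ∈ T := ⟨huT.1.trans huv.reachable, hne⟩
      refine hv ((hS C v).mpr ⟨hvT, ?_⟩)
      rw [← huC]
      exact SimpleGraph.ConnectedComponent.sound (SimpleGraph.Adj.reachable huv.symm)
    · obtain ⟨⟨u, hu⟩, rfl⟩ := C.exists_rep
      obtain ⟨p⟩ := hu.1.symm
      obtain ⟨d, -, hd1, hd2⟩ := p.exists_boundary_dart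
        (S (F.connectedComponentMk ⟨u, hu⟩) : Set V) ((hS _ u).mpr ⟨hu, rfl⟩) hi
      exact ⟨d.fst, d.snd, hd1, hd2, d.adj⟩
  have hdisj : Set.PairwiseDisjoint (Finset.univ : Finset F.ConnectedComponent) S := by
    intro C _ D _ hCD
    refine Finset.disjoint_left.mpr fun v hC hD => hCD ?_
    obtain ⟨_, rfl⟩ := (hS C v).mp hC
    obtain ⟨_, rfl⟩ := (hS D v).mp hD
    rfl
  calc (Nat.card F.ConnectedComponent : ℝ)
      = ∑ _C : F.ConnectedComponent, (1 : ℝ) := by simp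
    _ ≤ ∑ C, ∑ v ∈ S C, (relRes G c Qd i v + relRes G c Qd j v) :=
        Finset.sum_le_sum fun C _ => hone C
    _ = ∑ v ∈ Finset.univ.biUnion S, (relRes G c Qd i v + relRes G c Qd j v) :=
        (Finset.sum_biUnion hdisj).symm
    _ ≤ _ := by
        refine Finset.sum_le_sum_of_subset_of_nonneg ?_ fun v _ _ =>
          add_nonneg (relRes_nonneg hsymm hpos hQd i v) (relRes_nonneg hsymm hpos hQd j v)
        intro v hv
        obtain ⟨C, -, hC⟩ := Finset.mem_biUnion.mp hv
        obtain ⟨hvT, -⟩ := (hS C v).mp hC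
        simpa using hvT.2

lemma sum_relRes_add_sum_relRes [DecidableEq V] (hsymm : ∀ i j, c i j = c j i) {i j : V}
    (hij : i ≠ j) :
    ∑ v, relRes G c Qd i v + ∑ v, relRes G c Qd j v = 2 * relRes G c Qd i j +
      ∑ v ∈ {i, j}ᶜ, (relRes G c Qd i v + relRes G c Qd j v) := by
  rw [← Finset.sum_add_distrib, ← Finset.sum_add_sum_compl {i, j}, Finset.sum_pair hij,
    relRes_of_not_adj (G.loopless.irrefl i), relRes_of_not_adj (G.loopless.irrefl j),
    relRes_comm hsymm j i]
  ring

end Curvature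

/- STATEMENT 11: the stronger upper bound
`κ_ij ≤ (6 - 2 β(G_i∖(i,j)) - β(G_i∖{i,j}))/ω_ij`, attained together with the lower
bound `(4 - d_i - d_j)/ω_ij` (and with the two bounds equal) if and only if all
links incident to `i` and to `j` are cut links. -/
theorem linkCurv_strong_upper_bound
    [Fintype V] [DecidableEq V] (G : SimpleGraph V) [DecidableRel G.Adj]
    (c : V → V → ℝ) (hsymm : ∀ i j, c i j = c j i)
    (hpos : ∀ i j, G.Adj i j → 0 < c i j)
    (Qd : Matrix V V ℝ) (hQd : IsMoorePenroseInv (lapMatrix G c) Qd)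
    (i j : V) (hij : G.Adj i j) :
    linkCurv G c Qd i j ≤
      (6 - 2 * (Nat.card ((SimpleGraph.induce {v | G.Reachable i v} G).deleteEdges
          {s((⟨i, SimpleGraph.Reachable.refl (G := G) i⟩ : {v | G.Reachable i v}),
             (⟨j, hij.reachable⟩ : {v | G.Reachable i v}))}).ConnectedComponent : ℝ) - (Nat.card (SimpleGraph.induce {v | G.Reachable i v ∧ v ≠ i ∧ v ≠ j} G).ConnectedComponent : ℝ)) / effRes Qd i j ∧
    ((linkCurv G c Qd i j =
          (6 - 2 * (Nat.card ((SimpleGraph.induce {v | G.Reachable i v} G).deleteEdges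
          {s((⟨i, SimpleGraph.Reachable.refl (G := G) i⟩ : {v | G.Reachable i v}),
             (⟨j, hij.reachable⟩ : {v | G.Reachable i v}))}).ConnectedComponent : ℝ) - (Nat.card (SimpleGraph.induce {v | G.Reachable i v ∧ v ≠ i ∧ v ≠ j} G).ConnectedComponent : ℝ)) / effRes Qd i j ∧
        linkCurv G c Qd i j =
          (4 - (G.degree i : ℝ) - (G.degree j : ℝ)) / effRes Qd i j ∧
        6 - 2 * (Nat.card ((SimpleGraph.induce {v | G.Reachable i v} G).deleteEdges
          {s((⟨i, SimpleGraph.Reachable.refl (G := G) i⟩ : {v | G.Reachable i v}),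
             (⟨j, hij.reachable⟩ : {v | G.Reachable i v}))}).ConnectedComponent : ℝ) - (Nat.card (SimpleGraph.induce {v | G.Reachable i v ∧ v ≠ i ∧ v ≠ j} G).ConnectedComponent : ℝ) =
          4 - (G.degree i : ℝ) - (G.degree j : ℝ)) ↔
      (∀ k, G.Adj i k → IsCutLink G i k) ∧ ∀ k, G.Adj j k → IsCutLink G j k) := by
  have hω := effRes_pos hsymm hpos hQd hij
  have hsum := sum_relRes_add_sum_relRes (G := G) (Qd := Qd) hsymm hij.ne
  have hB₁ := card_component_deleteEdges_le hsymm hpos hQd hij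
  have hB₂ := card_component_deleteVerts_le hsymm hpos hQd hij
  have hi := sum_relRes_le_degree hsymm hpos hQd i
  have hj := sum_relRes_le_degree hsymm hpos hQd j
  simp only [linkCurv_eq, div_le_div_iff_of_pos_right hω, div_left_inj' hω.ne']
  refine ⟨by linarith, ?_⟩
  have hcut : ∀ u, (∀ k, G.Adj u k → IsCutLink G u k) ↔
      ∀ k, G.Adj u k → G.IsBridge s(u, k) := fun u =>
    forall₂_congr fun k hk => by rw [isCutLink_iff, and_iff_right hk]
  rw [hcut, hcut]
  constructor
  · rintro ⟨-, h, -⟩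
    exact ⟨(sum_relRes_eq_degree_iff hsymm hpos hQd i).mp (by linarith),
      (sum_relRes_eq_degree_iff hsymm hpos hQd j).mp (by linarith)⟩
  · rintro ⟨hbi, hbj⟩
    have hdi := (sum_relRes_eq_degree_iff hsymm hpos hQd i).mpr hbi
    have hdj := (sum_relRes_eq_degree_iff hsymm hpos hQd j).mpr hbj
    have hdeg : (G.degree i : ℝ) + G.degree j ≤ Nat.card (SimpleGraph.induce
        {v | G.Reachable i v ∧ v ≠ i ∧ v ≠ j} G).ConnectedComponent + 2 := by
      exact_mod_cast degree_add_degree_le hij hbi hbj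
    have htwo := two_le_card_connectedComponent
      (H := (SimpleGraph.induce {v | G.Reachable i v} G).deleteEdges
        {s((⟨i, SimpleGraph.Reachable.refl (G := G) i⟩ : {v | G.Reachable i v}),
          (⟨j, hij.reachable⟩ : {v | G.Reachable i v}))})
      (a := ⟨i, SimpleGraph.Reachable.refl (G := G) i⟩) (b := ⟨j, hij.reachable⟩) (by
        intro hr
        refine SimpleGraph.isBridge_iff.mp (hbi j hij) (hr.map
          (⟨Subtype.val, ?_⟩ : _ →g G.deleteEdges {s(i, j)}))
        intro u v huv
        rw [SimpleGraph.deleteEdges_adj] at huv ⊢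
        refine ⟨huv.1, fun h => huv.2 ?_⟩
        simpa [Sym2.eq_iff, Subtype.ext_iff] using h)
    have htwo' : (2 : ℝ) ≤ Nat.card ((SimpleGraph.induce {v | G.Reachable i v} G).deleteEdges
        {s((⟨i, SimpleGraph.Reachable.refl (G := G) i⟩ : {v | G.Reachable i v}),
          (⟨j, hij.reachable⟩ : {v | G.Reachable i v}))}).ConnectedComponent := by
      exact_mod_cast htwo
    have hr := (relRes_eq_one_iff_isBridge hsymm hpos hQd hij).mpr (hbi j hij)
    refine ⟨?_, ?_, ?_⟩ <;> linarith
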